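/- arXiv:2309.00826 — 3 statements merged into one kernel-verified Lean document; each statement's English description precedes it below -/
import Mathlib

section
/- Let d ≥ 1 be an integer and Φ : ℕ → [2, ∞) a function. If the series ∑_{n=1}^∞ (log Φ(n))^{d−1} / Φ(n) converges, then the set Λ_d(Φ) has Lebesgue measure zero. -/
open MeasureTheory Filter Set

/-- The Gauss map `T(x) = 1/x - ⌊1/x⌋` (with `T(0) = 0`). -/
noncomputable def gaussMap (x : ℝ) : ℝ := if x = 0 then 0 else 1 / x - (⌊1 / x⌋ : ℝ)

/-- The `n`-th partial quotient `a_n(x) = ⌊1 / T^{n-1}(x)⌋` (for `n ≥ 1`). -/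
noncomputable def pq (n : ℕ) (x : ℝ) : ℕ := ⌊1 / (gaussMap^[n - 1] x)⌋₊

/-- `Λ_d(Φ)`: irrational `x ∈ [0,1)` with `a_n(x) a_{2n}(x) ⋯ a_{dn}(x) ≥ Φ(n)`
for infinitely many `n`. -/
def Lambda (d : ℕ) (Φ : ℕ → ℝ) : Set ℝ :=
  {x | x ∈ Set.Ico (0 : ℝ) 1 ∧ Irrational x ∧
    ∃ᶠ n in Filter.atTop, Φ n ≤ ∏ i ∈ Finset.Icc 1 d, (pq (i * n) x : ℝ)}

noncomputable def gm : Measure ℝ :=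
  (volume.restrict (Ico (0:ℝ) 1)).withDensity (fun x => ENNReal.ofReal (1 / (1 + x)))

noncomputable def aone (x : ℝ) : ℕ := ⌊1 / x⌋₊

theorem meas_aone : Measurable aone := by
  unfold aone
  exact Nat.measurable_floor.comp (by fun_prop)

theorem meas_gauss : Measurable gaussMap := by
  unfold gaussMap
  apply Measurable.ite (measurableSet_singleton 0) measurable_const
  apply Measurable.sub (by fun_prop)
  exact (measurable_from_top (f := fun z : ℤ => (z : ℝ))).comp (Int.measurable_floor.comp (by fun_prop))

theorem gm_apply {A : Set ℝ} (hA : MeasurableSet A) :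
    gm A = ∫⁻ x in A ∩ Ico (0:ℝ) 1, ENNReal.ofReal (1 / (1 + x)) := by
  rw [gm, withDensity_apply _ hA, Measure.restrict_restrict hA]

theorem gm_le_vol {A : Set ℝ} (hA : MeasurableSet A) : gm A ≤ volume (A ∩ Ico (0:ℝ) 1) := by
  rw [gm_apply hA]
  calc _ ≤ ∫⁻ x in A ∩ Ico (0:ℝ) 1, 1 := by
        apply setLIntegral_mono measurable_const
        intro x hx
        have := hx.2.1
        rw [ENNReal.ofReal_le_one, div_le_one (by linarith)]
        linarith
    _ = _ := by simp

theorem gm_le_one (A : Set ℝ) : gm A ≤ 1 := by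
  calc gm A ≤ gm univ := measure_mono (subset_univ _)
    _ ≤ _ := gm_le_vol MeasurableSet.univ
    _ ≤ 1 := by simp

theorem gm_zero : gm {x | aone x = 0} = 0 := by
  have : MeasurableSet {x | aone x = 0} := meas_aone (measurableSet_singleton 0)
  refine le_antisymm ((gm_le_vol this).trans ?_) (zero_le)
  calc _ ≤ volume ({0} : Set ℝ) := by
        apply measure_mono
        rintro x ⟨h, h0, h1⟩
        simp only [mem_ofPred_eq, aone, Nat.floor_eq_zero] at h
        by_contra hx
        have hx : 0 < x := lt_of_le_of_ne h0 (fun h => hx (by simp [h]))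
        rw [div_lt_one hx] at h
        linarith
    _ ≤ 0 := by simp

theorem gm_branch {A : Set ℝ} (hA : MeasurableSet A) (k : ℕ) :
    gm (gaussMap ⁻¹' A ∩ {x | aone x = k + 1}) ≤
      ∫⁻ y in A ∩ Ico (0:ℝ) 1, ENNReal.ofReal (1 / ((k + 1 + y) * (k + 2 + y))) := by
  have hm : MeasurableSet (gaussMap ⁻¹' A ∩ {x | aone x = k + 1}) :=
    (meas_gauss hA).inter (meas_aone (measurableSet_singleton (k+1)))
  have hAI := hA.inter (measurableSet_Ico (a := (0:ℝ)) (b := 1))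
  rw [gm_apply hm]
  have hsub : gaussMap ⁻¹' A ∩ {x | aone x = k + 1} ∩ Ico (0:ℝ) 1 ⊆
      (fun y : ℝ => 1 / (k + 1 + y)) '' (A ∩ Ico (0:ℝ) 1) := by
    rintro x ⟨⟨hxA, hxk⟩, h0, h1⟩
    have hx0 : x ≠ 0 := by
      rintro rfl
      simp [aone] at hxk
    have hx : 0 < x := lt_of_le_of_ne h0 (Ne.symm hx0)
    have hfl : (⌊1 / x⌋ : ℝ) = k + 1 := by
      have h2 : ((⌊1/x⌋₊ : ℕ) : ℝ) = (⌊1/x⌋ : ℝ) := natCast_floor_eq_intCast_floor (by positivity)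
      rw [← h2]
      simp only [mem_ofPred_eq, aone] at hxk
      rw [hxk]; push_cast; ring
    have hg : gaussMap x = 1 / x - (k + 1) := by
      rw [gaussMap, if_neg hx0, hfl]
    refine ⟨gaussMap x, ⟨hxA, ?_, ?_⟩, ?_⟩
    · rw [gaussMap, if_neg hx0]; exact sub_nonneg.2 (Int.floor_le _)
    · rw [gaussMap, if_neg hx0]; linarith [Int.lt_floor_add_one (1/x)]
    · simp only [hg]; rw [add_sub_cancel, one_div_one_div]
  refine (lintegral_mono_set hsub).trans ?_
  rw [lintegral_image_eq_lintegral_abs_deriv_mul (f' := fun y : ℝ => -1 / (k + 1 + y)^2) hAI]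
  · apply setLIntegral_mono' hAI
    intro y hy
    have hy0 : 0 ≤ y := hy.2.1
    have hk : (0:ℝ) ≤ k := Nat.cast_nonneg k
    rw [← ENNReal.ofReal_mul (abs_nonneg _)]
    apply ENNReal.ofReal_le_ofReal
    rw [neg_div, abs_neg, abs_of_nonneg (by positivity)]
    apply le_of_eq
    have h1 : (k:ℝ) + 1 + y ≠ 0 := by positivity
    have h2 : (k:ℝ) + 2 + y ≠ 0 := by positivity
    have h3 : 1 + 1 / ((k:ℝ) + 1 + y) = (k + 2 + y) / (k + 1 + y) := by
      field_simp; ring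
    rw [h3]
    field_simp
  · intro y hy
    have hy0 : 0 ≤ y := hy.2.1
    have h1 : (k:ℝ) + 1 + y ≠ 0 := by positivity
    have := ((hasDerivAt_id y).const_add ((k:ℝ)+1)).inv h1
    have e : (fun y : ℝ => 1 / ((k:ℝ) + 1 + y)) = (fun y : ℝ => (k:ℝ) + 1 + id y)⁻¹ := by
      funext z; simp
    rw [e]
    exact this.hasDerivWithinAt
  · intro y _ z _ h
    simpa using h

theorem gm_branch_le {A : Set ℝ} (hA : MeasurableSet A) (k : ℕ) :
    gm (gaussMap ⁻¹' A ∩ {x | aone x = k + 1}) ≤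
      ENNReal.ofReal (2 / ((k + 1) * (k + 2))) * gm A := by
  refine (gm_branch hA k).trans ?_
  have hAI := hA.inter (measurableSet_Ico (a := (0:ℝ)) (b := 1))
  rw [gm_apply hA, ← lintegral_const_mul _ (by fun_prop)]
  apply setLIntegral_mono' hAI
  intro y hy
  have hy0 : 0 ≤ y := hy.2.1
  have hy1 : y < 1 := hy.2.2
  have hk : (0:ℝ) ≤ k := Nat.cast_nonneg k
  rw [← ENNReal.ofReal_mul (by positivity)]
  apply ENNReal.ofReal_le_ofReal
  rw [div_mul_div_comm, div_le_div_iff₀ (by positivity) (by positivity)]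
  have : ((k:ℝ)+1)*(k+2) ≤ (k+1+y)*(k+2+y) := by nlinarith [mul_nonneg hk hy0]
  have h2 : 0 ≤ ((k:ℝ)+1)*(k+2) := by positivity
  nlinarith

theorem cover (B : Set ℝ) : gm B ≤ ∑' k : ℕ, gm (B ∩ {x | aone x = k + 1}) := by
  have : B ⊆ {x | aone x = 0} ∪ ⋃ k : ℕ, (B ∩ {x | aone x = k + 1}) := by
    intro x hx
    rcases h : aone x with _ | k
    · left; exact h
    · right; exact mem_iUnion.2 ⟨k, hx, h⟩
  calc gm B ≤ _ := measure_mono this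
    _ ≤ _ := measure_union_le _ _
    _ ≤ _ := by rw [gm_zero, zero_add]; exact measure_iUnion_le _

theorem gm_inv {A : Set ℝ} (hA : MeasurableSet A) : gm (gaussMap ⁻¹' A) ≤ gm A := by
  have hAI := hA.inter (measurableSet_Ico (a := (0:ℝ)) (b := 1))
  refine (cover _).trans ((ENNReal.tsum_le_tsum (gm_branch hA)).trans ?_)
  rw [← lintegral_tsum (fun k => by fun_prop), gm_apply hA]
  apply setLIntegral_mono' hAI
  intro y hy
  have hy0 : 0 ≤ y := hy.2.1
  apply ENNReal.tsum_le_of_sum_range_le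
  intro n
  rw [← ENNReal.ofReal_sum_of_nonneg (fun i _ => by positivity)]
  apply ENNReal.ofReal_le_ofReal
  have : ∑ i ∈ Finset.range n, 1 / (((i:ℝ) + 1 + y) * (i + 2 + y)) = 1 / (1 + y) - 1 / (n + 1 + y) := by
    induction n with
    | zero => simp
    | succ n ih =>
      rw [Finset.sum_range_succ, ih]
      have h1 : (n:ℝ) + 1 + y ≠ 0 := by positivity
      have h2 : (n:ℝ) + 2 + y ≠ 0 := by positivity
      have h3 : (n:ℝ) + 1 + 1 + y ≠ 0 := by positivity
      have h4 : 1 + y ≠ 0 := by positivity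
      push_cast
      field_simp
      ring
  rw [this]
  have : 0 ≤ 1 / ((n:ℝ) + 1 + y) := by positivity
  linarith

theorem gm_inv_iter {A : Set ℝ} (hA : MeasurableSet A) (m : ℕ) :
    gm (gaussMap^[m] ⁻¹' A) ≤ gm A := by
  induction m with
  | zero => simp
  | succ m ih =>
    rw [Function.iterate_succ, preimage_comp]
    exact (gm_inv (meas_gauss.iterate m hA)).trans ih

def SS (m d : ℕ) (t : ℝ) : Set ℝ :=
  {x | t ≤ ∏ i ∈ Finset.range (d+1), (aone (gaussMap^[i * (m+1)] x) : ℝ)}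

theorem meas_SS (m d : ℕ) (t : ℝ) : MeasurableSet (SS m d t) := by
  apply measurableSet_le measurable_const
  apply Finset.measurable_prod
  intro i _
  exact (measurable_from_top (f := fun z : ℕ => (z : ℝ))).comp
    (meas_aone.comp (meas_gauss.iterate _))

theorem real_sum (C L t : ℝ) (d : ℕ) (hC : 0 ≤ C) (ht : 1 ≤ t) (hL : L = 1 + Real.log t) (N : ℕ) :
    ∑ k ∈ Finset.range N, (2 / (((k:ℝ) + 1) * (k + 2))) *
      (if (k:ℝ) + 1 ≤ t then C * L ^ d / (t / (k+1)) else 1) ≤ (2 * C + 2) * L ^ (d+1) / t := by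
  have hL1 : 1 ≤ L := by rw [hL]; linarith [Real.log_nonneg ht]
  have ht0 : 0 < t := by linarith
  have key : ∀ N : ℕ, ∑ k ∈ Finset.range N, (2 / (((k:ℝ) + 1) * (k + 2))) *
      (if (k:ℝ) + 1 ≤ t then C * L ^ d / (t / (k+1)) else 1) ≤
      2 * C * L^d / t * ∑ k ∈ Finset.range (min N ⌊t⌋₊), 1 / ((k:ℝ) + 1)
       + (2 / ((⌊t⌋₊:ℝ) + 1) - 2 / ((max N ⌊t⌋₊ : ℕ) + 1 : ℝ)) := by
    intro N
    induction N with
    | zero => simp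
    | succ N ih =>
      rw [Finset.sum_range_succ]
      split_ifs with h
      · have h' : N + 1 ≤ ⌊t⌋₊ := Nat.le_floor (by push_cast; exact h)
        rw [min_eq_left h', max_eq_right h']
        rw [min_eq_left (by omega), max_eq_right (by omega)] at ih
        rw [Finset.sum_range_succ, mul_add (2 * C * L^d / t)]
        have : 2 / (((N:ℝ) + 1) * (N + 2)) * (C * L ^ d / (t / (N+1))) ≤
            2 * C * L^d / t * (1 / ((N:ℝ) + 1)) := by
          have e1 : 2 / (((N:ℝ) + 1) * (N + 2)) * (C * L ^ d / (t / (N+1))) =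
            2 * C * L^d / t * (1 / ((N:ℝ) + 2)) := by field_simp
          rw [e1]
          gcongr
          norm_num
        linarith
      · have h' : ⌊t⌋₊ < N + 1 := by
          rw [Nat.floor_lt ht0.le]; push_cast; linarith
        rw [min_eq_right (by omega), max_eq_left (by omega)]
        rw [min_eq_right (by omega), max_eq_left (by omega)] at ih
        have : 2 / (((N:ℝ) + 1) * (N + 2)) = 2 / ((N:ℝ)+1) - 2 / ((N:ℝ) + 2) := by
          field_simp; ring
        have e : (((N + 1 : ℕ)):ℝ) + 1 = N + 2 := by push_cast; ring
        rw [e, this]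
        linarith
  refine (key N).trans ?_
  have h1 : ∑ k ∈ Finset.range (min N ⌊t⌋₊), 1 / ((k:ℝ) + 1) ≤ L := by
    calc _ ≤ ∑ k ∈ Finset.range ⌊t⌋₊, 1 / ((k:ℝ) + 1) := by
          apply Finset.sum_le_sum_of_subset_of_nonneg
          · simp
          · intros; positivity
      _ = (harmonic ⌊t⌋₊ : ℝ) := by simp [harmonic]
      _ ≤ L := by rw [hL]; exact harmonic_floor_le_one_add_log t ht
  have h2 : 2 / ((⌊t⌋₊:ℝ) + 1) ≤ 2 / t := by
    gcongr
    exact (Nat.lt_floor_add_one t).le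
  have h3 : 0 ≤ 2 / ((max N ⌊t⌋₊ : ℕ) + 1 : ℝ) := by positivity
  have h4 : 2 * C * L^d / t * ∑ k ∈ Finset.range (min N ⌊t⌋₊), 1 / ((k:ℝ) + 1) ≤
      2 * C * L^d / t * L := by gcongr
  have h5 : 2 / t ≤ 2 * L^(d+1) / t := by
    gcongr
    have := one_le_pow₀ hL1 (n := d+1)
    linarith
  calc _ ≤ 2 * C * L^d / t * L + 2 * L^(d+1) / t := by linarith
    _ = _ := by rw [pow_succ]; ring

noncomputable def CC : ℕ → ℝ
  | 0 => 1
  | d+1 => 2 * CC d + 2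

theorem CC_nonneg (d : ℕ) : 0 ≤ CC d := by
  induction d with
  | zero => simp [CC]
  | succ d ih => simp only [CC]; linarith

theorem SS_bound (m d : ℕ) (t : ℝ) (ht : 1 ≤ t) :
    gm (SS m d t) ≤ ENNReal.ofReal (CC d * (1 + Real.log t) ^ d / t) := by
  induction d generalizing t with
  | zero =>
    refine (gm_le_vol (meas_SS _ _ _)).trans ?_
    have : SS m 0 t ∩ Ico (0:ℝ) 1 ⊆ Icc 0 (1/t) := by
      rintro x ⟨hx, h0, h1⟩
      simp only [SS, aone, mem_ofPred_eq, zero_add, Finset.range_one, Finset.prod_singleton,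
        zero_mul, Function.iterate_zero, id_eq] at hx
      refine ⟨h0, ?_⟩
      have h3 : t ≤ 1 / x := hx.trans (Nat.floor_le (by positivity))
      have hx0 : 0 < x := by
        rcases h0.eq_or_lt with h | h
        · subst h; simp at h3; linarith
        · exact h
      rw [le_div_iff₀ hx0] at h3
      rw [le_div_iff₀ (by linarith)]
      linarith
    refine (measure_mono this).trans ?_
    simp [CC]
  | succ d ih =>
    have ht0 : 0 < t := by linarith
    refine (cover _).trans ?_
    have hb : ∀ k : ℕ, gm (SS m (d+1) t ∩ {x | aone x = k + 1}) ≤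
        ENNReal.ofReal ((2 / (((k:ℝ) + 1) * (k + 2))) *
      (if (k:ℝ) + 1 ≤ t then CC d * (1 + Real.log t) ^ d / (t / (k+1)) else 1)) := by
      intro k
      have hsub : SS m (d+1) t ∩ {x | aone x = k + 1} ⊆
          gaussMap ⁻¹' (gaussMap^[m] ⁻¹' (SS m d (t / (k+1)))) ∩ {x | aone x = k + 1} := by
        rintro x ⟨hx, hk⟩
        refine ⟨?_, hk⟩
        simp only [SS, mem_ofPred_eq, mem_preimage] at hx hk ⊢
        rw [Finset.prod_range_succ', zero_mul, Function.iterate_zero, id, hk] at hx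
        push_cast at hx
        rw [div_le_iff₀ (by positivity)]
        have e : ∀ i : ℕ, gaussMap^[i * (m+1)] (gaussMap^[m] (gaussMap x)) =
            gaussMap^[(i+1) * (m+1)] x := by
          intro i
          rw [← Function.iterate_succ_apply, ← Function.iterate_add_apply]
          rw [show i * (m+1) + m.succ = (i+1) * (m+1) by rw [Nat.succ_eq_add_one]; ring]
        simp only [e]
        exact hx
      refine (measure_mono hsub).trans ((gm_branch_le (meas_gauss.iterate m (meas_SS _ _ _)) k).trans ?_)
      rw [ENNReal.ofReal_mul (by positivity)]
      gcongr
      refine (gm_inv_iter (meas_SS _ _ _) m).trans ?_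
      split_ifs with h
      · have h1 : 1 ≤ t / (k+1) := by rw [le_div_iff₀ (by positivity)]; linarith
        refine (ih _ h1).trans (ENNReal.ofReal_le_ofReal ?_)
        have h2 : Real.log (t / (k+1)) ≤ Real.log t := by
          apply Real.log_le_log (by linarith)
          apply div_le_self ht0.le
          have : (0:ℝ) ≤ k := Nat.cast_nonneg k
          linarith
        have h3 := Real.log_nonneg h1
        have := CC_nonneg d
        gcongr
      · simpa using gm_le_one _
    refine (ENNReal.tsum_le_tsum hb).trans ?_
    apply ENNReal.tsum_le_of_sum_range_le
    intro N
    have := CC_nonneg d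
    have hl := Real.log_nonneg ht
    rw [← ENNReal.ofReal_sum_of_nonneg]
    · exact ENNReal.ofReal_le_ofReal (real_sum (CC d) _ t d this ht rfl N)
    · intro k _
      split_ifs <;> positivity

/-- If `∑ (log Φ(n))^{d-1} / Φ(n) < ∞`, then `Λ_d(Φ)` has Lebesgue measure zero. -/
theorem lambda_measure_zero_of_summable (d : ℕ) (hd : 1 ≤ d) (Φ : ℕ → ℝ)
    (hΦ : ∀ n, 2 ≤ Φ n)
    (hsum : Summable fun n => (Real.log (Φ n)) ^ (d - 1) / Φ n) :
    volume (Lambda d Φ) = 0 := by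
  obtain ⟨e, rfl⟩ : ∃ e, d = e + 1 := ⟨d - 1, by omega⟩
  simp only [Nat.add_sub_cancel] at hsum
  have hprod : ∀ (m : ℕ) (x : ℝ), ∏ i ∈ Finset.Icc 1 (e+1), (pq (i * (m+1)) x : ℝ) =
      ∏ i ∈ Finset.range (e+1), (aone (gaussMap^[i * (m+1)] (gaussMap^[m] x)) : ℝ) := by
    intro m x
    have : Finset.Icc 1 (e+1) = Finset.Ico 1 (e+1+1) := by ext; simp
    rw [this, Finset.prod_Ico_eq_prod_range]
    apply Finset.prod_congr rfl
    intro i _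
    rw [pq, aone, ← Function.iterate_add_apply]
    have : (1 + i) * (m+1) - 1 = i * (m+1) + m := by
      rw [add_mul]; omega
    rw [this]
  have hl2 : 0 < Real.log 2 := Real.log_pos (by norm_num)
  set K : ℝ := 1 + 1 / Real.log 2 with hK
  have hK0 : 0 ≤ K := by positivity
  have hbd : ∀ m : ℕ, gm (gaussMap^[m] ⁻¹' SS m e (Φ (m+1))) ≤
      ENNReal.ofReal (CC e * K ^ e * ((Real.log (Φ (m+1))) ^ e / Φ (m+1))) := by
    intro m
    have h2 := hΦ (m+1)
    refine (gm_inv_iter (meas_SS _ _ _) m).trans ((SS_bound m e _ (by linarith)).trans ?_)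
    apply ENNReal.ofReal_le_ofReal
    have hl : Real.log 2 ≤ Real.log (Φ (m+1)) := Real.log_le_log (by norm_num) h2
    have h3 : 1 + Real.log (Φ (m+1)) ≤ K * Real.log (Φ (m+1)) := by
      have : 1 ≤ 1 / Real.log 2 * Real.log (Φ (m+1)) := by
        rw [one_div, inv_mul_eq_div, le_div_iff₀ hl2]; linarith
      rw [hK]; linarith
    have := CC_nonneg e
    have h5 : 0 ≤ 1 + Real.log (Φ (m+1)) := by linarith
    calc _ ≤ CC e * (K * Real.log (Φ (m+1))) ^ e / Φ (m+1) := by gcongr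
      _ = _ := by rw [mul_pow]; ring
  have hfin : ∑' m : ℕ, gm {x | x ∈ gaussMap^[m] ⁻¹' SS m e (Φ (m+1))} ≠ ⊤ := by
    have hs : Summable fun m : ℕ => CC e * K ^ e * ((Real.log (Φ (m+1))) ^ e / Φ (m+1)) :=
      ((summable_nat_add_iff 1).2 hsum).mul_left _
    exact ne_top_of_le_ne_top hs.tsum_ofReal_ne_top (ENNReal.tsum_le_tsum hbd)
  have h0 := measure_setOfPred_frequently_eq_zero hfin
  have hac : volume.restrict (Ico (0:ℝ) 1) ≪ gm := by
    apply withDensity_absolutelyContinuous' (by fun_prop)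
    rw [ae_restrict_iff' measurableSet_Ico]
    refine ae_of_all _ fun x hx => ?_
    have : 0 < 1 / (1 + x) := by have := hx.1; positivity
    exact (ENNReal.ofReal_pos.2 this).ne'
  have h1 := hac h0
  have hsub : Lambda (e+1) Φ ⊆
      {x | ∃ᶠ m in atTop, x ∈ gaussMap^[m] ⁻¹' SS m e (Φ (m+1))} ∩ Ico (0:ℝ) 1 := by
    rintro x ⟨hx, -, hf⟩
    refine ⟨?_, hx⟩
    rw [← map_add_atTop_eq_nat 1, frequently_map] at hf
    refine hf.mono fun m hm => ?_
    rw [hprod] at hm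
    exact hm
  refine measure_mono_null hsub ?_
  rwa [Measure.restrict_apply' measurableSet_Ico] at h1
end

section
/- Let d ≥ 1 be an integer and Φ : ℕ → [2, ∞) a function. If the series ∑_{n=1}^∞ (log Φ(n))^{d−1} / Φ(n) diverges, then the set Λ_d(Φ) has full Lebesgue measure in [0,1), i.e. its Lebesgue measure equals 1. -/
open MeasureTheory Filter Set

noncomputable def geomM : Measure ℕ :=
  Measure.sum (fun k => (2⁻¹ : ENNReal) ^ (k + 1) • Measure.dirac k)

theorem lintegral_geomM (g : ℕ → ENNReal) :
    ∫⁻ k, g k ∂geomM = ∑' k, (2⁻¹ : ENNReal) ^ (k + 1) * g k := by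
  simp [geomM, lintegral_sum_measure, lintegral_smul_measure]

theorem geomM_singleton (m : ℕ) : geomM {m} = (2⁻¹ : ENNReal) ^ (m + 1) := by
  rw [← lintegral_indicator_one (measurableSet_singleton m), lintegral_geomM,
    tsum_eq_single m]
  · simp
  · intro b hb
    simp [hb]

theorem tsum_half : ∑' k : ℕ, (2⁻¹ : ENNReal) ^ (k + 1) = 1 := by
  rw [ENNReal.tsum_geometric_add_one, ENNReal.one_sub_inv_two, inv_inv]
  exact ENNReal.inv_mul_cancel (by norm_num) (by norm_num)

instance : IsProbabilityMeasure geomM := ⟨by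
  have := lintegral_geomM (fun _ => 1)
  simp only [lintegral_const, one_mul, mul_one] at this
  rw [this, tsum_half]⟩

/-- layer cake -/
theorem layer (g : ℕ → ENNReal) (hg : Monotone g) :
    ∃ D : ℕ → ENNReal, ∀ k, g k = ∑' j, D j * (if j ≤ k then 1 else 0) := by
  refine ⟨fun j => if j = 0 then g 0 else g j - g (j - 1), fun k => ?_⟩
  rw [tsum_eq_sum (s := Finset.range (k + 1))]
  · induction k with
    | zero => simp
    | succ k ih =>
      rw [Finset.sum_range_succ]
      have : ∑ x ∈ Finset.range (k + 1), (if x = 0 then g 0 else g x - g (x - 1)) *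
          (if x ≤ k + 1 then (1 : ENNReal) else 0) = g k := by
        rw [ih]
        refine Finset.sum_congr rfl fun x hx => ?_
        have := Finset.mem_range.1 hx
        rw [if_pos (show x ≤ k + 1 by omega), if_pos (show x ≤ k by omega)]
      rw [this]
      simp [add_tsub_cancel_of_le (hg (Nat.le_succ k))]
  · intro b hb
    have : ¬ b ≤ k := by simpa [Nat.lt_succ_iff] using hb
    simp [this]

theorem layer_tsum (w : ℕ → ENNReal) (L : ℕ → ℕ) (g D : ℕ → ENNReal)
    (h : ∀ k, g k = ∑' j, D j * (if j ≤ k then 1 else 0)) :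
    ∑' m, w m * g (L m) = ∑' j, D j * ∑' m, w m * (if j ≤ L m then 1 else 0) := by
  simp_rw [h, ← ENNReal.tsum_mul_left]
  rw [ENNReal.tsum_comm]
  refine tsum_congr fun j => tsum_congr fun m => by ring

noncomputable def pr (r : ℝ) (m : ℕ) : ℝ := (1 + r) / ((m + 1 + r) * (m + 2 + r))

theorem pr_nonneg {r : ℝ} (hr : 0 ≤ r) (m : ℕ) : 0 ≤ pr r m := by
  unfold pr; positivity

theorem hasSum_pr {r : ℝ} (hr : 0 ≤ r) (M : ℕ) :
    HasSum (fun m => pr r (m + M)) ((1 + r) / (M + 1 + r)) := by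
  rw [hasSum_iff_tendsto_nat_of_nonneg (fun i => pr_nonneg hr _)]
  have : ∀ n, ∑ i ∈ Finset.range n, pr r (i + M) =
      (1 + r) / (M + 1 + r) - (1 + r) / ((n : ℝ) + (M + 1 + r)) := by
    intro n
    induction n with
    | zero => simp
    | succ n ih =>
      rw [Finset.sum_range_succ, ih]
      unfold pr
      push_cast
      have h1 : (M : ℝ) + 1 + r ≠ 0 := by positivity
      have h2 : (n : ℝ) + (M + 1 + r) ≠ 0 := by positivity
      have h3 : (n : ℝ) + 1 + (M + 1 + r) ≠ 0 := by positivity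
      have h4 : (n : ℝ) + M + 1 + r ≠ 0 := by positivity
      have h5 : (n : ℝ) + M + 2 + r ≠ 0 := by positivity
      field_simp
      ring
  simp_rw [this]
  have h : Tendsto (fun n : ℕ => (1 + r) / ((n : ℝ) + (M + 1 + r))) atTop (nhds 0) :=
    Tendsto.const_div_atTop (tendsto_atTop_add_const_right _ _ tendsto_natCast_atTop_atTop) _
  simpa using tendsto_const_nhds.sub h

theorem tail_pr {r : ℝ} (hr : 0 ≤ r) (j : ℕ) :
    (2⁻¹ : ENNReal) ^ j ≤
      ∑' m, ENNReal.ofReal (pr r m) * (if j ≤ Nat.log 2 (m + 1) then 1 else 0) := by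
  have h1 : (2⁻¹ : ENNReal) ^ j ≤ ENNReal.ofReal ((1 + r) / ((2 ^ j - 1 : ℕ) + 1 + r)) := by
    have h2 : ((2 ^ j - 1 : ℕ) : ℝ) + 1 = 2 ^ j := by
      have := Nat.sub_add_cancel (Nat.one_le_two_pow (n := j))
      exact_mod_cast this
    rw [h2]
    have h3 : (2⁻¹ : ENNReal) ^ j = ENNReal.ofReal (1 / 2 ^ j) := by
      rw [one_div, ← inv_pow, ENNReal.ofReal_pow (by positivity),
        ENNReal.ofReal_inv_of_pos (by norm_num)]
      simp
    rw [h3]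
    apply ENNReal.ofReal_le_ofReal
    have h4 : (1 : ℝ) ≤ 2 ^ j := one_le_pow₀ (by norm_num)
    rw [div_le_div_iff₀ (by positivity) (by positivity)]
    nlinarith
  refine h1.trans ?_
  have h := hasSum_pr hr (2 ^ j - 1)
  rw [← h.tsum_eq, ENNReal.ofReal_tsum_of_nonneg (fun i => pr_nonneg hr _) h.summable]
  have : ∀ n, ENNReal.ofReal (pr r (n + (2 ^ j - 1))) =
      (fun m => ENNReal.ofReal (pr r m) * (if j ≤ Nat.log 2 (m + 1) then 1 else 0))
        (n + (2 ^ j - 1)) := by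
    intro n
    have h5 : j ≤ Nat.log 2 (n + (2 ^ j - 1) + 1) := by
      apply Nat.le_log_of_pow_le (by norm_num)
      have := Nat.sub_add_cancel (Nat.one_le_two_pow (n := j))
      omega
    simp [h5]
  refine le_trans (le_of_eq (tsum_congr this)) ?_
  exact ENNReal.tsum_comp_le_tsum_of_injective (add_left_injective (2 ^ j - 1)) _

theorem tail_geom (j : ℕ) :
    ∑' m : ℕ, (2⁻¹ : ENNReal) ^ (m + 1) * (if j ≤ m then 1 else 0) ≤ (2⁻¹ : ENNReal) ^ j := by
  have h : ∑' m : ℕ, (2⁻¹ : ENNReal) ^ (m + 1) * (if j ≤ m then 1 else 0) =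
      ∑ m ∈ Finset.range j, (2⁻¹ : ENNReal) ^ (m + 1) * (if j ≤ m then 1 else 0) +
      ∑' m : ℕ, (2⁻¹ : ENNReal) ^ ((m + j) + 1) * (if j ≤ m + j then 1 else 0) :=
    (ENNReal.summable.sum_add_tsum_nat_add' (f := fun m : ℕ => (2⁻¹ : ENNReal) ^ (m + 1) * (if j ≤ m then 1 else 0)) (k := j)).symm
  rw [h, Finset.sum_eq_zero, zero_add]
  · simp only [le_add_iff_nonneg_left, zero_le, if_true, mul_one]
    have : ∀ m : ℕ, (2⁻¹ : ENNReal) ^ ((m + j) + 1) = (2⁻¹ : ENNReal) ^ j * (2⁻¹ : ENNReal) ^ (m + 1) := by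
      intro m; ring
    simp_rw [this, ENNReal.tsum_mul_left, tsum_half, mul_one]
    exact le_rfl
  · intro m hm
    have : ¬ j ≤ m := by simpa using hm
    simp [this]

theorem dom1 {r : ℝ} (hr : 0 ≤ r) (g : ℕ → ENNReal) (hg : Monotone g) :
    ∫⁻ k, g k ∂geomM ≤ ∑' m, ENNReal.ofReal (pr r m) * g (Nat.log 2 (m + 1)) := by
  obtain ⟨D, hD⟩ := layer g hg
  rw [lintegral_geomM, layer_tsum _ (fun m => Nat.log 2 (m + 1)) g D hD,
    layer_tsum _ (fun m => m) g D hD]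
  exact ENNReal.tsum_le_tsum fun j => mul_le_mul_right ((tail_geom j).trans (tail_pr hr j)) _

noncomputable def dens (r t : ℝ) : ENNReal := ENNReal.ofReal ((1 + r) / (1 + r * t) ^ 2)

theorem image_branch (j : ℕ) : (fun s : ℝ => 1 / ((j : ℝ) + 1 + s)) '' Ioo 0 1 =
    Ioo (1 / ((j : ℝ) + 2)) (1 / ((j : ℝ) + 1)) := by
  ext t
  simp only [mem_image, mem_Ioo]
  constructor
  · rintro ⟨s, ⟨h0, h1⟩, rfl⟩
    constructor
    · apply one_div_lt_one_div_of_lt <;> first | positivity | linarith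
    · apply one_div_lt_one_div_of_lt <;> first | positivity | linarith
  · rintro ⟨h0, h1⟩
    have ht : 0 < t := lt_trans (by positivity) h0
    refine ⟨1 / t - (j + 1), ⟨?_, ?_⟩, ?_⟩
    · rw [lt_div_iff₀ (by positivity)] at h1
      rw [sub_pos, lt_div_iff₀ ht]; linarith
    · rw [div_lt_iff₀ (by positivity)] at h0
      rw [sub_lt_iff_lt_add, div_lt_iff₀ ht]; linarith
    · simp

theorem step {r : ℝ} (hr : 0 ≤ r) (F : ℝ → ENNReal) :
    ∑' j : ℕ, ENNReal.ofReal (pr r j) *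
      ∫⁻ s in Ioo (0 : ℝ) 1, F (1 / ((j : ℝ) + 1 + s)) * dens (1 / ((j : ℝ) + 1 + r)) s
    ≤ ∫⁻ t in Ioo (0 : ℝ) 1, F t * dens r t := by
  have key : ∀ j : ℕ, ENNReal.ofReal (pr r j) *
      ∫⁻ s in Ioo (0 : ℝ) 1, F (1 / ((j : ℝ) + 1 + s)) * dens (1 / ((j : ℝ) + 1 + r)) s
      = ∫⁻ t in Ioo (1 / ((j : ℝ) + 2)) (1 / ((j : ℝ) + 1)), F t * dens r t := by
    intro j
    rw [← image_branch, lintegral_image_eq_lintegral_abs_deriv_mul (f' := fun s => -1 / ((j : ℝ) + 1 + s) ^ 2) measurableSet_Ioo]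
    · rw [← lintegral_const_mul' _ _ ENNReal.ofReal_ne_top]
      refine setLIntegral_congr_fun measurableSet_Ioo fun s hs => ?_
      have hs0 := hs.1
      simp only [dens]
      rw [mul_left_comm, mul_left_comm (ENNReal.ofReal |_|), ← ENNReal.ofReal_mul (pr_nonneg hr _),
        ← ENNReal.ofReal_mul (abs_nonneg _)]
      congr 2
      rw [abs_div, abs_neg, abs_one, abs_of_pos (by positivity)]
      unfold pr
      have h1 : (j : ℝ) + 1 + r ≠ 0 := by positivity
      have h2 : (j : ℝ) + 1 + s ≠ 0 := by positivity
      have h3 : (j : ℝ) + 2 + r ≠ 0 := by positivity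
      have h4 : (j : ℝ) + 1 + s + r ≠ 0 := by positivity
      have e1 : 1 + 1 / ((j : ℝ) + 1 + r) = (j + 2 + r) / (j + 1 + r) := by field_simp; ring
      have e2 : 1 + 1 / ((j : ℝ) + 1 + r) * s = (j + 1 + s + r) / (j + 1 + r) := by field_simp; ring
      have e3 : 1 + r * (1 / ((j : ℝ) + 1 + s)) = (j + 1 + s + r) / (j + 1 + s) := by field_simp
      rw [e1, e2, e3]
      field_simp
    · intro s hs
      have h2 : (j : ℝ) + 1 + s ≠ 0 := by have := hs.1; positivity
      have := ((hasDerivAt_id s).const_add ((j : ℝ) + 1)).inv h2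
      simp only [one_div]
      exact this.hasDerivWithinAt
    · intro s hs t ht h
      have h2 : (j : ℝ) + 1 + s ≠ 0 := by have := hs.1; positivity
      have h3 : (j : ℝ) + 1 + t ≠ 0 := by have := ht.1; positivity
      simpa using h
  simp_rw [key]
  rw [← lintegral_iUnion (fun j => measurableSet_Ioo)]
  · apply lintegral_mono_set
    apply iUnion_subset
    intro j
    apply Ioo_subset_Ioo
    · positivity
    · rw [div_le_one (by positivity)]; linarith [(Nat.cast_nonneg j : (0:ℝ) ≤ j)]
  · have aux : ∀ i j : ℕ, i < j → Disjoint (Ioo (1 / ((i : ℝ) + 2)) (1 / ((i : ℝ) + 1)))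
        (Ioo (1 / ((j : ℝ) + 2)) (1 / ((j : ℝ) + 1))) := by
      intro i j hij
      rw [Set.disjoint_left]
      rintro x ⟨h1, _⟩ ⟨_, h2⟩
      have : 1 / ((j : ℝ) + 1) ≤ 1 / ((i : ℝ) + 2) := by
        apply one_div_le_one_div_of_le (by positivity)
        have : ((i + 1 : ℕ) : ℝ) ≤ j := by exact_mod_cast hij
        push_cast at this; linarith
      linarith
    intro i j hij
    rcases lt_or_gt_of_ne hij with h | h
    · exact aux i j h
    · exact (aux j i h).symm

theorem floor_branch (j : ℕ) {s : ℝ} (hs : s ∈ Ioo (0 : ℝ) 1) :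
    ⌊1 / (1 / ((j : ℝ) + 1 + s))⌋₊ = j + 1 := by
  rw [one_div_one_div, Nat.floor_eq_iff (by have := hs.1; positivity)]
  push_cast
  constructor <;> linarith [hs.1, hs.2]

theorem gauss_branch (j : ℕ) {s : ℝ} (hs : s ∈ Ioo (0 : ℝ) 1) :
    gaussMap (1 / ((j : ℝ) + 1 + s)) = s := by
  have h2 : (j : ℝ) + 1 + s ≠ 0 := by have := hs.1; positivity
  have : ⌊(j : ℝ) + 1 + s⌋ = (j : ℤ) + 1 := by
    rw [Int.floor_eq_iff]
    push_cast
    constructor <;> linarith [hs.1, hs.2]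
  unfold gaussMap
  rw [if_neg (by positivity), one_div_one_div, this]
  push_cast; ring

theorem lintegral_dens {r : ℝ} (hr : 0 ≤ r) : ∫⁻ t in Ioo (0 : ℝ) 1, dens r t = 1 := by
  have himg : (fun t : ℝ => (1 + r) * t / (1 + r * t)) '' Ioo 0 1 = Ioo 0 1 := by
    ext y
    simp only [mem_image, mem_Ioo]
    constructor
    · rintro ⟨t, ⟨h0, h1⟩, rfl⟩
      refine ⟨by positivity, ?_⟩
      rw [div_lt_one (by positivity)]
      linarith
    · rintro ⟨h0, h1⟩
      have hp : 0 < 1 + r * (1 - y) := by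
        have : 0 < 1 - y := by linarith
        positivity
      refine ⟨y / (1 + r * (1 - y)), ⟨by positivity, ?_⟩, ?_⟩
      · rw [div_lt_one hp]
        nlinarith
      · have e : 1 + r * (y / (1 + r * (1 - y))) = (1 + r) / (1 + r * (1 - y)) := by
          field_simp; ring
        rw [e]
        have : 1 + r ≠ 0 := by positivity
        field_simp
  have h := lintegral_image_eq_lintegral_abs_deriv_mul (s := Ioo (0 : ℝ) 1)
    (f := fun t : ℝ => (1 + r) * t / (1 + r * t)) (f' := fun t => (1 + r) / (1 + r * t) ^ 2)
    measurableSet_Ioo ?_ ?_ (fun _ => 1)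
  · rw [himg] at h
    simp only [lintegral_const, Measure.restrict_apply_univ, Real.volume_Ioo, sub_zero,
      ENNReal.ofReal_one, mul_one] at h
    rw [h]
    refine setLIntegral_congr_fun measurableSet_Ioo fun s hs => ?_
    have hs0 := hs.1
    simp only [dens]
    rw [abs_of_pos (by positivity)]
  · intro t ht
    have h0 := ht.1
    have h1 : 1 + r * t ≠ 0 := by positivity
    have := ((hasDerivAt_id t).const_mul (1 + r)).div
      (((hasDerivAt_id t).const_mul r).const_add 1) h1
    refine HasDerivAt.hasDerivWithinAt ?_
    have e1 : (1 + r) / (1 + r * t) ^ 2 = ((1 + r) * 1 * (1 + r * id t) -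
        (1 + r) * id t * (r * 1)) / (1 + r * id t) ^ 2 := by
      simp only [id]
      congr 1
      ring
    rw [e1]
    exact this
  · intro s hs t ht h
    have h0 := ht.1
    have h0' := hs.1
    have h1 : 1 + r * t ≠ 0 := by positivity
    have h2 : 1 + r * s ≠ 0 := by positivity
    have h3 : 1 + r ≠ 0 := by positivity
    simp only at h
    rw [div_eq_div_iff h2 h1] at h
    have : (1 + r) * (s - t) = 0 := by linarith
    rcases mul_eq_zero.1 this with h | h
    · exact absurd h h3
    · linarith

noncomputable def Ld (i : ℕ) (t : ℝ) : ℕ := Nat.log 2 ⌊1 / (gaussMap^[i] t)⌋₊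

theorem dom (N : ℕ) : ∀ (r : ℝ), 0 ≤ r → ∀ f : (Fin N → ℕ) → ENNReal, Monotone f →
    ∫⁻ v, f v ∂(Measure.pi fun _ => geomM) ≤
      ∫⁻ t in Ioo (0 : ℝ) 1, f (fun i => Ld i t) * dens r t := by
  induction N with
  | zero =>
    intro r hr f hf
    have : ∀ v : Fin 0 → ℕ, f v = f default := fun v => congrArg f (Subsingleton.elim _ _)
    simp_rw [this]
    rw [lintegral_const_mul _ (by unfold dens; fun_prop), lintegral_dens hr]
    simp
  | succ N ih =>
    intro r hr f hf
    refine le_trans ?_ (step hr _)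
    have h1 : ∀ j : ℕ, ∫⁻ v, f (Fin.cons (Nat.log 2 (j + 1)) v) ∂(Measure.pi fun _ : Fin N => geomM) ≤
        ∫⁻ s in Ioo (0 : ℝ) 1, f (fun i : Fin (N + 1) => Ld i (1 / ((j : ℝ) + 1 + s))) *
          dens (1 / ((j : ℝ) + 1 + r)) s := by
      intro j
      refine (ih (1 / ((j : ℝ) + 1 + r)) (by positivity)
        (fun v => f (Fin.cons (Nat.log 2 (j + 1)) v)) ?_).trans ?_
      · intro v w hvw
        apply hf
        exact Fin.cons_le_cons.2 ⟨le_rfl, hvw⟩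
      · apply le_of_eq
        refine setLIntegral_congr_fun measurableSet_Ioo fun s hs => ?_
        congr 2
        funext i
        refine Fin.cases ?_ (fun i => ?_) i
        · simp only [Fin.cons_zero, Ld, Fin.val_zero, Function.iterate_zero, id, floor_branch j hs]
        · simp only [Fin.cons_succ, Ld, Fin.val_succ, Function.iterate_succ, Function.comp,
            gauss_branch j hs]
    refine le_trans ?_ (ENNReal.tsum_le_tsum fun j => mul_le_mul_right (h1 j) _)
    refine le_trans ?_ (dom1 hr (fun k => ∫⁻ v, f (Fin.cons k v) ∂(Measure.pi fun _ : Fin N => geomM)) ?_)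
    · have mp := (measurePreserving_piFinSuccAbove (fun _ : Fin (N + 1) => geomM) 0).symm
      rw [← mp.lintegral_comp_emb (MeasurableEquiv.measurableEmbedding _),
        lintegral_prod _ (Measurable.of_discrete.aemeasurable)]
      apply le_of_eq
      refine lintegral_congr fun k => lintegral_congr fun v => ?_
      congr 1
      simp [MeasurableEquiv.piFinSuccAbove, Fin.insertNthEquiv]
    · intro k l hkl
      apply lintegral_mono
      intro v
      apply hf
      exact Fin.cons_le_cons.2 ⟨hkl, le_rfl⟩

open ProbabilityTheory in
theorem prob_sum (e : ℕ) : ∀ (S : Finset ℕ), S.card = e + 1 → ∀ m : ℕ,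
    (2⁻¹ : ENNReal) ^ (m + e + 1) * ((m + e).choose e : ℕ) ≤
      Measure.infinitePi (fun _ : ℕ => geomM) {ω | ∑ j ∈ S, ω j = m} := by
  have hind : iIndepFun (fun (i : ℕ) (ω : ℕ → ℕ) => ω i) (Measure.infinitePi (fun _ : ℕ => geomM)) :=
    iIndepFun_infinitePi (X := fun _ k => k) (fun _ => measurable_id)
  have hm : ∀ i : ℕ, Measurable (fun ω : ℕ → ℕ => ω i) := fun i => measurable_pi_apply i
  have hone : ∀ a m : ℕ, Measure.infinitePi (fun _ : ℕ => geomM) {ω : ℕ → ℕ | ω a = m} =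
      (2⁻¹ : ENNReal) ^ (m + 1) := by
    intro a m
    have h := Measure.infinitePi_map_eval (fun _ : ℕ => geomM) a
    have h2 := Measure.map_apply (μ := Measure.infinitePi (fun _ : ℕ => geomM)) (hm a)
      (measurableSet_singleton m)
    rw [h, geomM_singleton m] at h2
    exact h2.symm
  induction e with
  | zero =>
    intro S hS m
    obtain ⟨a, rfl⟩ := Finset.card_eq_one.1 hS
    simp [hone]
  | succ e ih =>
    intro S hS m
    obtain ⟨a, S', ha, rfl, hS'⟩ := Finset.card_eq_succ.1 hS
    have hi := hind.indepFun_finsetSum_of_notMem hm ha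
    have hk : ∀ k ∈ Finset.range (m + 1),
        (2⁻¹ : ENNReal) ^ (m + (e + 1) + 1) * ((k + e).choose e : ℕ) ≤
        Measure.infinitePi (fun _ : ℕ => geomM) {ω : ℕ → ℕ | ∑ j ∈ S', ω j = k ∧ ω a = m - k} := by
      intro k hk
      have hk' : k ≤ m := Nat.lt_succ_iff.1 (Finset.mem_range.1 hk)
      have := hi.measure_inter_preimage_eq_mul {k} {m - k} (measurableSet_singleton _) (measurableSet_singleton _)
      have e1 : {ω : ℕ → ℕ | ∑ j ∈ S', ω j = k ∧ ω a = m - k} =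
        (∑ j ∈ S', fun ω : ℕ → ℕ => ω j) ⁻¹' {k} ∩ (fun ω : ℕ → ℕ => ω a) ⁻¹' {m - k} := by
        ext ω; simp
      have e2 : (∑ j ∈ S', fun ω : ℕ → ℕ => ω j) ⁻¹' {k} = {ω : ℕ → ℕ | ∑ j ∈ S', ω j = k} := by
        ext ω; simp
      have e3 : (fun ω : ℕ → ℕ => ω a) ⁻¹' {m - k} = {ω : ℕ → ℕ | ω a = m - k} := rfl
      rw [e1, this, e2, e3, hone]
      refine le_trans (le_of_eq ?_) (mul_le_mul_left (ih S' hS' k) _)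
      have : m + (e + 1) + 1 = (k + e + 1) + (m - k + 1) := by omega
      rw [this, pow_add]
      ring
    have hsub : (⋃ k ∈ Finset.range (m + 1), {ω : ℕ → ℕ | ∑ j ∈ S', ω j = k ∧ ω a = m - k}) ⊆
        {ω : ℕ → ℕ | ∑ j ∈ insert a S', ω j = m} := by
      intro ω hω
      simp only [mem_iUnion, Finset.mem_range, mem_ofPred_eq] at hω
      obtain ⟨k, hk, h1, h2⟩ := hω
      simp only [mem_ofPred_eq, Finset.sum_insert ha]
      omega
    refine le_trans ?_ (measure_mono hsub)
    rw [measure_biUnion_finset]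
    · refine le_trans (le_of_eq ?_) (Finset.sum_le_sum hk)
      rw [← Finset.mul_sum, ← Nat.cast_sum, Nat.sum_range_add_choose]
      rfl
    · intro i _ j _ hij
      rw [Function.onFun, Set.disjoint_left]
      rintro ω ⟨h1, _⟩ ⟨h2, _⟩
      exact hij (h1.symm.trans h2)
    · intro k _
      exact ((measurableSet_eq_fun (by fun_prop) measurable_const).inter
        (measurableSet_eq_fun (hm a) measurable_const))

open ProbabilityTheory in
theorem blocks_indep (S : ℕ → Finset ℕ) (hS : ∀ i j, i ≠ j → Disjoint (S i) (S j)) (m : ℕ → ℕ) :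
    iIndepSet (fun n => {ω : ℕ → ℕ | m n ≤ ∑ j ∈ S n, ω j})
      (Measure.infinitePi (fun _ : ℕ => geomM)) := by
  have hind : iIndepFun (fun (i : ℕ) (ω : ℕ → ℕ) => ω i) (Measure.infinitePi (fun _ : ℕ => geomM)) :=
    iIndepFun_infinitePi (X := fun _ k => k) (fun _ => measurable_id)
  have hm : ∀ i : ℕ, Measurable (fun ω : ℕ → ℕ => ω i) := fun i => measurable_pi_apply i
  have hmeas : ∀ n, MeasurableSet {ω : ℕ → ℕ | m n ≤ ∑ j ∈ S n, ω j} := fun n =>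
    measurableSet_le measurable_const (by fun_prop)
  rw [iIndepSet_iff_meas_biInter hmeas]
  intro s
  induction s using Finset.induction_on with
  | empty => simp
  | insert a s ha ih =>
    rw [Finset.prod_insert ha, ← ih, Finset.set_biInter_insert]
    have hd : Disjoint (S a) (s.biUnion S) := by
      rw [Finset.disjoint_biUnion_right]
      intro i hi
      exact hS a i (fun h => ha (h ▸ hi))
    have hi := hind.indepFun_finset (S a) (s.biUnion S) hd hm
    have := hi.measure_inter_preimage_eq_mul
      {v | m a ≤ ∑ j : S a, v j}
      {v | ∀ n (hn : n ∈ s), m n ≤ ∑ j : S n, v ⟨j, Finset.mem_biUnion.2 ⟨n, hn, j.2⟩⟩}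
      (measurableSet_le measurable_const (by fun_prop)) ?_
    · convert this using 2
      · congr 1
        · ext ω
          simp only [mem_ofPred_eq, mem_preimage]
          rw [Finset.sum_coe_sort (S a) (fun j => ω j)]
        · ext ω
          simp only [mem_iInter, mem_ofPred_eq, mem_preimage]
          refine forall₂_congr fun n hn => ?_
          rw [Finset.sum_coe_sort (S n) (fun j => ω j)]
      · congr 1
        ext ω
        simp only [mem_ofPred_eq, mem_preimage]
        rw [Finset.sum_coe_sort (S a) (fun j => ω j)]
      · congr 1
        ext ω
        simp only [mem_iInter, mem_ofPred_eq, mem_preimage]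
        refine forall₂_congr fun n hn => ?_
        rw [Finset.sum_coe_sort (S n) (fun j => ω j)]
    · exact (Set.to_countable _).measurableSet

def blk (d n : ℕ) : Finset ℕ := (Finset.Icc 1 d).image (fun i => i * (n + 1) - 1)

theorem blk_inj (d n : ℕ) : Set.InjOn (fun i => i * (n + 1) - 1) (Finset.Icc 1 d : Set ℕ) := by
  intro i hi j hj h
  simp only [Finset.coe_Icc, mem_Icc] at hi hj
  have h1 : 1 ≤ i * (n + 1) := Nat.mul_pos hi.1 (Nat.succ_pos n)
  have h2 : 1 ≤ j * (n + 1) := Nat.mul_pos hj.1 (Nat.succ_pos n)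
  simp only at h
  have : i * (n + 1) = j * (n + 1) := by omega
  exact Nat.eq_of_mul_eq_mul_right (Nat.succ_pos n) this

theorem blk_card (d n : ℕ) : (blk d n).card = d := by
  unfold blk
  rw [Finset.card_image_of_injOn (blk_inj d n)]
  simp

def col (d n : ℕ) : Fin (d + 1) → Fin (d + 1) := fun p => Fin.ofNat (d + 1) ((n + 1).factorization p)

theorem blk_disj (d n m : ℕ) (hc : col d n = col d m) (hnm : n ≠ m) :
    Disjoint (blk d n) (blk d m) := by
  rw [Finset.disjoint_left]
  intro x hx hy
  simp only [blk, Finset.mem_image, Finset.mem_Icc] at hx hy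
  obtain ⟨i, ⟨hi1, hid⟩, hi⟩ := hx
  obtain ⟨j, ⟨hj1, hjd⟩, hj⟩ := hy
  have h1 : 1 ≤ i * (n + 1) := Nat.mul_pos hi1 (Nat.succ_pos n)
  have h2 : 1 ≤ j * (m + 1) := Nat.mul_pos hj1 (Nat.succ_pos m)
  have h : i * (n + 1) = j * (m + 1) := by omega
  have hij : i = j := by
    apply Nat.eq_of_factorization_eq (by omega) (by omega)
    intro p
    by_cases hp : p ≤ d
    · have hcp := congrFun hc ⟨p, by omega⟩
      simp only [col, Fin.ext_iff, Fin.ofNat] at hcp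
      have hf : (i * (n + 1)).factorization p = (j * (m + 1)).factorization p := by rw [h]
      rw [Nat.factorization_mul (by omega) (by omega),
        Nat.factorization_mul (by omega) (by omega), Finsupp.add_apply, Finsupp.add_apply] at hf
      have b1 := Nat.factorization_lt (n := i) p (by omega)
      have b2 := Nat.factorization_lt (n := j) p (by omega)
      have hmod : i.factorization p ≡ j.factorization p [MOD (d + 1)] := by
        apply Nat.ModEq.add_right_cancel (c := (n + 1).factorization p) (d := (m + 1).factorization p) hcp
        rw [hf]
      exact hmod.eq_of_lt_of_lt (by omega) (by omega)
    · rw [Nat.factorization_eq_zero_of_lt (by omega), Nat.factorization_eq_zero_of_lt (by omega)]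
  subst hij
  have := Nat.eq_of_mul_eq_mul_left hi1 h
  omega

theorem bc (e : ℕ) (m : ℕ → ℕ) (hm : ∀ n, 1 ≤ m n)
    (hsum : ∑' n, (2⁻¹ : ENNReal) ^ (m n + e + 1) * ((m n + e).choose e : ℕ) = ⊤) :
    ∀ᵐ ω ∂Measure.infinitePi (fun _ : ℕ => geomM),
      ∃ᶠ n in atTop, m n ≤ ∑ j ∈ blk (e + 1) n, ω j := by
  classical
  have hsplit : ∑ κ, ∑' n, (if col (e + 1) n = κ then
      (2⁻¹ : ENNReal) ^ (m n + e + 1) * ((m n + e).choose e : ℕ) else 0) = ⊤ := by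
    rw [← hsum, ← tsum_fintype (L := .unconditional _), ENNReal.tsum_comm]
    refine tsum_congr fun n => ?_
    rw [tsum_fintype]
    simp
  obtain ⟨κ, _, hκ⟩ := ENNReal.sum_eq_top.1 hsplit
  let S : ℕ → Finset ℕ := fun n => if col (e + 1) n = κ then blk (e + 1) n else ∅
  have hS : ∀ i j, i ≠ j → Disjoint (S i) (S j) := by
    intro i j hij
    simp only [S]
    split_ifs with h1 h2
    · exact blk_disj _ _ _ (h1.trans h2.symm) hij
    all_goals simp
  have hlim := ProbabilityTheory.measure_limsup_eq_one
    (μ := Measure.infinitePi (fun _ : ℕ => geomM))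
    (s := fun n => {ω : ℕ → ℕ | m n ≤ ∑ j ∈ S n, ω j})
    (fun n => measurableSet_le measurable_const (by fun_prop)) (blocks_indep S hS m) (by
      rw [eq_top_iff, ← hκ]
      refine ENNReal.tsum_le_tsum fun n => ?_
      split_ifs with h
      · refine (prob_sum e (blk (e + 1) n) (blk_card _ _) (m n)).trans (measure_mono ?_)
        intro ω hω
        simp only [mem_ofPred_eq] at hω
        simp [S, h, hω]
      · simp)
  have hlm : MeasurableSet (limsup (fun n => {ω : ℕ → ℕ | m n ≤ ∑ j ∈ S n, ω j}) atTop) :=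
    MeasurableSet.measurableSet_limsup (fun n => measurableSet_le measurable_const (by fun_prop))
  have hae := (prob_compl_eq_zero_iff hlm).2 hlim
  have hae' : ∀ᵐ ω ∂Measure.infinitePi (fun _ : ℕ => geomM),
    ω ∈ limsup (fun n => {ω : ℕ → ℕ | m n ≤ ∑ j ∈ S n, ω j}) atTop := hae
  filter_upwards [hae'] with ω hω
  rw [Filter.mem_limsup_iff_frequently_mem] at hω
  refine hω.mono fun n hn => ?_
  simp only [mem_ofPred_eq, S] at hn
  split_ifs at hn with h
  · exact hn
  · have := hm n
    simp at hn
    omega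

theorem map_fin (N : ℕ) : (Measure.infinitePi (fun _ : ℕ => geomM)).map
    (fun ω (i : Fin N) => ω i) = Measure.pi (fun _ => geomM) := by
  have hind : ProbabilityTheory.iIndepFun (fun (i : ℕ) (ω : ℕ → ℕ) => ω i) (Measure.infinitePi (fun _ : ℕ => geomM)) :=
    ProbabilityTheory.iIndepFun_infinitePi (X := fun _ k => k) (fun _ => measurable_id)
  have h2 := hind.precomp (g := fun i : Fin N => (i : ℕ)) Fin.val_injective
  rw [ProbabilityTheory.iIndepFun_iff_map_fun_eq_pi_map
    (fun i => (measurable_pi_apply _).aemeasurable)] at h2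
  rw [h2]
  congr 1
  funext i
  exact Measure.infinitePi_map_eval (fun _ : ℕ => geomM) (i : ℕ)

theorem transfer (d : ℕ) (m : ℕ → ℕ) (M K : ℕ) :
    Measure.infinitePi (fun _ : ℕ => geomM)
      {ω | ∃ n, M ≤ n ∧ n < K ∧ m n ≤ ∑ j ∈ blk d n, ω j} ≤
    volume.restrict (Ioo (0 : ℝ) 1) {x | ∃ n, M ≤ n ∧ m n ≤ ∑ j ∈ blk d n, Ld j x} := by
  let ext : (Fin (d * K) → ℕ) → ℕ → ℕ := fun v j => if h : j < d * K then v ⟨j, h⟩ else 0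
  have hext : ∀ v w, v ≤ w → ∀ j, ext v j ≤ ext w j := by
    intro v w h j
    simp only [ext]
    split_ifs
    · exact h _
    · exact le_rfl
  let B : Set (Fin (d * K) → ℕ) := {v | ∃ n, M ≤ n ∧ n < K ∧ m n ≤ ∑ j ∈ blk d n, ext v j}
  have h1 : Measure.infinitePi (fun _ : ℕ => geomM)
      {ω | ∃ n, M ≤ n ∧ n < K ∧ m n ≤ ∑ j ∈ blk d n, ω j} ≤ Measure.pi (fun _ => geomM) B := by
    rw [← map_fin, Measure.map_apply (by fun_prop) (Set.to_countable _).measurableSet]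
    apply measure_mono
    rintro ω ⟨n, hM, hK, h⟩
    refine ⟨n, hM, hK, h.trans (le_of_eq (Finset.sum_congr rfl fun j hj => ?_))⟩
    have : j < d * K := by
      simp only [blk, Finset.mem_image, Finset.mem_Icc] at hj
      obtain ⟨i, ⟨hi1, hid⟩, hi⟩ := hj
      have h1 : 1 ≤ i * (n + 1) := Nat.mul_pos hi1 (Nat.succ_pos n)
      have h2 : i * (n + 1) ≤ d * K := Nat.mul_le_mul hid hK
      omega
    simp [ext, this]
  refine h1.trans ?_
  have hmono : Monotone (B.indicator (1 : (Fin (d * K) → ℕ) → ENNReal)) := by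
    intro v w hvw
    by_cases hv : v ∈ B
    · have hw : w ∈ B := by
        obtain ⟨n, hM, hK, h⟩ := hv
        exact ⟨n, hM, hK, h.trans (Finset.sum_le_sum fun j _ => hext v w hvw j)⟩
      simp [hv, hw]
    · simp [hv]
  have h2 := dom (d * K) 0 le_rfl _ hmono
  rw [lintegral_indicator_one (Set.to_countable _).measurableSet] at h2
  refine h2.trans ?_
  refine le_trans (lintegral_mono fun t => ?_) (lintegral_indicator_one_le _)
  have hd : dens 0 t = 1 := by simp [dens]
  rw [hd, mul_one]
  by_cases ht : (fun i : Fin (d * K) => Ld i t) ∈ B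
  · have : t ∈ {x | ∃ n, M ≤ n ∧ m n ≤ ∑ j ∈ blk d n, Ld j x} := by
      obtain ⟨n, hM, hK, h⟩ := ht
      refine ⟨n, hM, h.trans (Finset.sum_le_sum fun j _ => ?_)⟩
      simp only [ext]
      split_ifs
      · exact le_rfl
      · exact Nat.zero_le _
    rw [indicator_of_mem ht, indicator_of_mem this]
    exact le_rfl
  · rw [indicator_of_notMem ht]
    exact zero_le

theorem meas_Ld (j : ℕ) : Measurable (Ld j) := by
  unfold Ld
  have h : Measurable (fun x : ℝ => 1 / (gaussMap^[j] x)) :=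
    measurable_const.div (meas_gauss.iterate j)
  exact (measurable_from_top (f := Nat.log 2)).comp (Nat.measurable_floor.comp h)

theorem ae_real (e : ℕ) (m : ℕ → ℕ) (hm : ∀ n, 1 ≤ m n)
    (hsum : ∑' n, (2⁻¹ : ENNReal) ^ (m n + e + 1) * ((m n + e).choose e : ℕ) = ⊤) :
    ∀ᵐ x ∂volume.restrict (Ioo (0 : ℝ) 1),
      ∃ᶠ n in atTop, m n ≤ ∑ j ∈ blk (e + 1) n, Ld j x := by
  have hprob : IsProbabilityMeasure (volume.restrict (Ioo (0 : ℝ) 1)) := ⟨by simp⟩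
  have hM : ∀ M : ℕ, ∀ᵐ x ∂volume.restrict (Ioo (0 : ℝ) 1),
      ∃ n, M ≤ n ∧ m n ≤ ∑ j ∈ blk (e + 1) n, Ld j x := by
    intro M
    have hmeas : MeasurableSet {x | ∃ n, M ≤ n ∧ m n ≤ ∑ j ∈ blk (e + 1) n, Ld j x} := by
      simp only [ofPred_exists, ofPred_and]
      refine MeasurableSet.iUnion fun n => (MeasurableSet.const _).inter
        (measurableSet_le measurable_const (Finset.measurable_sum _ fun j _ => meas_Ld j))
    have h1 : volume.restrict (Ioo (0 : ℝ) 1) {x | ∃ n, M ≤ n ∧ m n ≤ ∑ j ∈ blk (e + 1) n, Ld j x} = 1 := by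
      apply le_antisymm prob_le_one
      have hU : Measure.infinitePi (fun _ : ℕ => geomM)
        (⋃ K, {ω | ∃ n, M ≤ n ∧ n < K ∧ m n ≤ ∑ j ∈ blk (e + 1) n, ω j}) = 1 := by
        rw [← measure_univ (μ := Measure.infinitePi (fun _ : ℕ => geomM))]
        apply measure_congr
        filter_upwards [bc e m hm hsum] with ω hω
        obtain ⟨n, hn, h⟩ := (frequently_atTop.1 hω) M
        refine eq_true ?_ |>.trans (eq_true ?_).symm
        · exact mem_iUnion.2 ⟨n + 1, n, hn, Nat.lt_succ_self n, h⟩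
        · trivial
      rw [← hU, Monotone.measure_iUnion]
      · exact iSup_le fun K => transfer (e + 1) m M K
      · rintro K K' hK ω ⟨n, h1, h2, h3⟩
        exact ⟨n, h1, lt_of_lt_of_le h2 hK, h3⟩
    exact (prob_compl_eq_zero_iff hmeas).2 h1
  filter_upwards [ae_all_iff.2 hM] with x hx
  rw [frequently_atTop]
  exact hx

theorem gauss_mem (y : ℝ) (h0 : 0 < y) (hirr : Irrational y) :
    gaussMap y ∈ Ioo (0 : ℝ) 1 ∧ Irrational (gaussMap y) := by
  have he : gaussMap y = y⁻¹ - (⌊1 / y⌋ : ℝ) := by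
    unfold gaussMap
    rw [if_neg h0.ne', one_div]
  have hir : Irrational (gaussMap y) := by
    rw [he]
    exact hirr.inv.sub_intCast _
  refine ⟨⟨lt_of_le_of_ne ?_ hir.ne_zero.symm, ?_⟩, hir⟩
  · rw [he, sub_nonneg, ← one_div]
    exact Int.floor_le _
  · rw [he, ← one_div]
    linarith [Int.lt_floor_add_one (1 / y)]

theorem orbit (x : ℝ) (hx : x ∈ Ioo (0 : ℝ) 1) (hi : Irrational x) (k : ℕ) :
    gaussMap^[k] x ∈ Ioo (0 : ℝ) 1 ∧ Irrational (gaussMap^[k] x) := by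
  induction k with
  | zero => exact ⟨hx, hi⟩
  | succ k ih =>
    rw [Function.iterate_succ_apply']
    exact gauss_mem _ ih.1.1 ih.2

theorem pow_Ld_le (x : ℝ) (hx : x ∈ Ioo (0 : ℝ) 1) (hi : Irrational x) (k : ℕ) :
    (2 : ℝ) ^ (Ld k x) ≤ (pq (k + 1) x : ℝ) := by
  obtain ⟨⟨h0, h1⟩, -⟩ := orbit x hx hi k
  have : 1 ≤ ⌊1 / (gaussMap^[k] x)⌋₊ := by
    rw [Nat.one_le_floor_iff, le_div_iff₀ h0]
    linarith
  unfold Ld pq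
  exact_mod_cast Nat.pow_log_le_self 2 (by simpa using (by omega : ⌊1 / (gaussMap^[k] x)⌋₊ ≠ 0))

/-- If `∑ (log Φ(n))^{d-1} / Φ(n) = ∞`, then `Λ_d(Φ)` has full Lebesgue measure in `[0,1)`. -/
theorem lambda_measure_one_of_not_summable (d : ℕ) (hd : 1 ≤ d) (Φ : ℕ → ℝ)
    (hΦ : ∀ n, 2 ≤ Φ n)
    (hsum : ¬ Summable fun n => (Real.log (Φ n)) ^ (d - 1) / Φ n) :
    volume (Lambda d Φ) = 1 := by
  obtain ⟨e, rfl⟩ : ∃ e, d = e + 1 := ⟨d - 1, by omega⟩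
  simp only [Nat.add_sub_cancel] at hsum
  rw [← summable_nat_add_iff 1] at hsum
  let m : ℕ → ℕ := fun n => ⌈Real.logb 2 (Φ (n + 1))⌉₊
  have hlogb : ∀ n, 1 ≤ Real.logb 2 (Φ (n + 1)) := by
    intro n
    rw [Real.le_logb_iff_rpow_le (by norm_num) (by linarith [hΦ (n + 1)])]
    simpa using hΦ (n + 1)
  have hm : ∀ n, 1 ≤ m n := fun n => Nat.one_le_ceil_iff.2 (by linarith [hlogb n])
  have hlow : ∀ n, Φ (n + 1) ≤ 2 ^ m n := by
    intro n
    have h1 : Real.logb 2 (Φ (n + 1)) ≤ m n := Nat.le_ceil _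
    rw [Real.logb_le_iff_le_rpow (by norm_num) (by linarith [hΦ (n + 1)])] at h1
    simpa using h1
  have hup : ∀ n, (2 : ℝ) ^ m n ≤ 2 * Φ (n + 1) := by
    intro n
    have h1 : (m n : ℝ) < Real.logb 2 (Φ (n + 1)) + 1 := Nat.ceil_lt_add_one (by linarith [hlogb n])
    have h2 : (m n : ℝ) - 1 ≤ Real.logb 2 (Φ (n + 1)) := by linarith
    rw [Real.le_logb_iff_rpow_le (by norm_num) (by linarith [hΦ (n + 1)]),
      Real.rpow_sub (by norm_num)] at h2
    simp only [Real.rpow_natCast, Real.rpow_one] at h2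
    linarith
  have hlog : ∀ n, Real.log (Φ (n + 1)) ≤ m n := by
    intro n
    refine le_trans ?_ (Nat.le_ceil _)
    rw [Real.logb, le_div_iff₀ (Real.log_pos (by norm_num))]
    have := Real.log_two_lt_d9
    have h3 : 0 ≤ Real.log (Φ (n + 1)) := Real.log_nonneg (by linarith [hΦ (n + 1)])
    nlinarith
  have htop : ∑' n, (2⁻¹ : ENNReal) ^ (m n + e + 1) * ((m n + e).choose e : ℕ) = ⊤ := by
    by_contra hne
    apply hsum
    have hs := ENNReal.summable_toReal hne
    refine Summable.of_nonneg_of_le (fun n => ?_) (fun n => ?_)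
      (hs.mul_left (2 * 2 ^ (e + 1) * (e.factorial : ℝ)))
    · have h3 : 0 ≤ Real.log (Φ (n + 1)) := Real.log_nonneg (by linarith [hΦ (n + 1)])
      have : 0 < Φ (n + 1) := by linarith [hΦ (n + 1)]
      positivity
    · have h3 : 0 ≤ Real.log (Φ (n + 1)) := Real.log_nonneg (by linarith [hΦ (n + 1)])
      have hp : 0 < Φ (n + 1) := by linarith [hΦ (n + 1)]
      have h4 : ((m n : ℝ)) ^ e ≤ (e.factorial : ℝ) * ((m n + e).choose e : ℕ) := by
        have h5 : (m n) ^ e ≤ e.factorial * (m n + e).choose e := by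
          rw [← Nat.ascFactorial_eq_factorial_mul_choose]
          exact (Nat.pow_le_pow_left (Nat.le_succ _) e).trans (Nat.pow_succ_le_ascFactorial _ _)
        exact_mod_cast h5
      have h6 : Real.log (Φ (n + 1)) ^ e ≤ (m n : ℝ) ^ e := pow_le_pow_left₀ h3 (hlog n) e
      simp only [ENNReal.toReal_mul, ENNReal.toReal_pow, ENNReal.toReal_inv, ENNReal.toReal_ofNat,
        ENNReal.toReal_natCast]
      rw [div_le_iff₀ hp, add_assoc (m n) e 1, pow_add _ (m n) (e + 1), inv_pow, inv_pow]
      have e1 : 2 * 2 ^ (e + 1) * (e.factorial : ℝ) * (((2 : ℝ) ^ m n)⁻¹ * ((2 : ℝ) ^ (e + 1))⁻¹ * ((m n + e).choose e : ℕ)) * Φ (n + 1)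
        = ((e.factorial : ℝ) * ((m n + e).choose e : ℕ)) * ((2 * Φ (n + 1)) / 2 ^ m n) := by
        field_simp
      rw [e1]
      refine (h6.trans h4).trans (le_mul_of_one_le_right (by positivity) ?_)
      rw [le_div_iff₀ (by positivity)]
      linarith [hup n]
  have hae := ae_real e m hm htop
  have hirr : ∀ᵐ x ∂volume.restrict (Ioo (0 : ℝ) 1), Irrational x := by
    apply ae_restrict_of_ae
    exact (Set.countable_range ((↑) : ℚ → ℝ)).ae_notMem volume
  have hmem : ∀ᵐ x ∂volume.restrict (Ioo (0 : ℝ) 1), x ∈ Lambda (e + 1) Φ := by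
    filter_upwards [hae, hirr, ae_restrict_mem measurableSet_Ioo] with x hx hi hxm
    refine ⟨⟨hxm.1.le, hxm.2⟩, hi, ?_⟩
    have hsh : ∃ᶠ n in atTop, Φ (n + 1) ≤ ∏ i ∈ Finset.Icc 1 (e + 1), (pq (i * (n + 1)) x : ℝ) := by
      refine hx.mono fun n hn => ?_
      refine (hlow n).trans ?_
      refine (pow_le_pow_right₀ (by norm_num : (1 : ℝ) ≤ 2) hn).trans ?_
      unfold blk
      rw [Finset.sum_image (blk_inj _ _), ← Finset.prod_pow_eq_pow_sum]
      refine Finset.prod_le_prod (fun _ _ => by positivity) fun i hi' => ?_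
      have h1 : 1 ≤ i * (n + 1) := Nat.mul_pos (Finset.mem_Icc.1 hi').1 (Nat.succ_pos n)
      have := pow_Ld_le x hxm hi (i * (n + 1) - 1)
      rwa [Nat.sub_add_cancel h1] at this
    exact (tendsto_add_atTop_nat 1).frequently hsh
  have hsub : Lambda (e + 1) Φ ⊆ Ico 0 1 := fun x hx => hx.1
  apply le_antisymm
  · simpa using measure_mono (μ := volume) hsub
  · calc (1 : ENNReal) = volume.restrict (Ioo (0 : ℝ) 1) univ := by simp
      _ = volume.restrict (Ioo (0 : ℝ) 1) (Lambda (e + 1) Φ) := by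
        apply measure_congr
        filter_upwards [hmem] with x hx
        exact (eq_true trivial).trans (eq_true hx).symm
      _ ≤ volume (Lambda (e + 1) Φ) := Measure.restrict_apply_le _ _
end

section
/- Let d ≥ 1 be an integer and Φ : ℕ → [2, ∞) a function with liminf_{n→∞} (log Φ(n))/n = ∞ and liminf_{n→∞} (log log Φ(n))/n = ∞ (i.e. B = ∞ and b = ∞). Then the Hausdorff dimension of Λ_d(Φ) equals 0. -/
open MeasureTheory Filter Set

lemma gauss_irr (t : ℝ) (h : Irrational t) : Irrational (gaussMap t) ∧ 0 < gaussMap t ∧ gaussMap t < 1 := by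
  have h0 : t ≠ 0 := h.ne_zero
  have hI : Irrational (gaussMap t) := by
    rw [gaussMap, if_neg h0, one_div]
    exact (irrational_inv_iff.2 h).sub_intCast _
  refine ⟨hI, lt_of_le_of_ne ?_ hI.ne_zero.symm, ?_⟩
  · rw [gaussMap, if_neg h0]; linarith [Int.floor_le (1/t)]
  · rw [gaussMap, if_neg h0]; linarith [Int.lt_floor_add_one (1/t)]

lemma iter_irr (x : ℝ) (h : Irrational x) (h0 : 0 < x) (h1 : x < 1) (n : ℕ) :
    Irrational (gaussMap^[n] x) ∧ 0 < gaussMap^[n] x ∧ gaussMap^[n] x < 1 := by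
  induction n with
  | zero => exact ⟨h, h0, h1⟩
  | succ n ih => rw [Function.iterate_succ_apply']; exact gauss_irr _ ih.1

lemma bd_inv {x t : ℝ} {K : ℕ} (H : ∀ a b : ℤ, 1 < b → 1 / (b:ℝ)^K ≤ |x - a / b|)
    {p q p' q' : ℤ} (hq : 1 ≤ q) (ht : 0 < t)
    (hD : q * x - p = - t * (q' * x - p')) (hD' : |q' * x - p'| ≤ 1) :
    1 / t ≤ (2 * q : ℝ)^K := by
  have hqR : (1:ℝ) ≤ q := by exact_mod_cast hq
  have h := H (2 * p) (2 * q) (by omega)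
  push_cast at h
  have e : x - 2 * p / (2 * q) = (q * x - p) / q := by field_simp
  rw [e, hD, abs_div, abs_mul, abs_neg, abs_of_pos ht, abs_of_pos (by linarith : (0:ℝ) < q)] at h
  have h2 : t * |q' * x - p'| / q ≤ t := by
    rw [div_le_iff₀ (by linarith)]
    nlinarith [abs_nonneg ((q':ℝ) * x - p')]
  have h3 := h.trans h2
  rw [div_le_iff₀ (by positivity)] at h3 ⊢
  linarith

lemma key {x : ℝ} (hx : Irrational x) (h0 : 0 < x) (h1 : x < 1) {K : ℕ}
    (H : ∀ a b : ℤ, 1 < b → 1 / (b:ℝ)^K ≤ |x - a / b|) (n : ℕ) :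
    ∃ p q p' q' : ℤ, 1 ≤ q ∧ 0 ≤ q' ∧ q' ≤ q ∧ (2 * q : ℝ) ≤ 2 ^ ((K+2)^n) ∧
      q * x - p = - (gaussMap^[n] x) * (q' * x - p') ∧ |q' * x - p'| ≤ 1 := by
  induction n with
  | zero => exact ⟨0, 1, 1, 0, by simp⟩
  | succ n ih =>
    obtain ⟨p, q, p', q', hq, hq0, hqq, hb, hD, hD'⟩ := ih
    obtain ⟨hi, ht0, ht1⟩ := iter_irr x hx h0 h1 n
    have hbi := bd_inv H hq ht0 hD hD'
    rw [Function.iterate_succ_apply']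
    set t := gaussMap^[n] x with ht
    have ha : 1 ≤ ⌊1 / t⌋ := by
      rw [Int.le_floor]; push_cast; rw [le_div_iff₀ ht0]; linarith
    have hqR : (1:ℝ) ≤ q := by exact_mod_cast hq
    have hqqR : (q':ℝ) ≤ q := by exact_mod_cast hqq
    have haR := Int.floor_le (1/t)
    refine ⟨⌊1/t⌋ * p + p', ⌊1/t⌋ * q + q', p, q, by nlinarith, by omega, by nlinarith, ?_, ?_, ?_⟩
    · push_cast
      have hP : (1:ℝ) ≤ (2 * q)^K := one_le_pow₀ (by linarith)
      calc 2 * ((⌊1/t⌋:ℝ) * q + q') ≤ 2 * ((2*q)^K * q + (2*q)^K * q) := by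
            have : (⌊1/t⌋:ℝ) * q ≤ (2*q)^K * q := by gcongr; linarith
            nlinarith
        _ = (2 * q)^K * (2 * q) * 2 := by ring
        _ ≤ (2 * q)^K * (2 * q) * (2 * q) := by gcongr; linarith
        _ = (2 * q : ℝ)^(K+2) := by ring
        _ ≤ (2 ^ ((K+2)^n))^(K+2) := by gcongr
        _ = _ := by rw [← pow_mul, ← pow_succ]
    · rw [gaussMap, if_neg ht0.ne']
      push_cast
      have : (q':ℝ) * x - p' = - (1/t) * (q * x - p) := by rw [hD]; field_simp
      linear_combination this
    · rw [hD, abs_mul, abs_neg, abs_of_pos ht0]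
      nlinarith [abs_nonneg ((q':ℝ) * x - p')]

lemma pq_bd {x : ℝ} (hx : Irrational x) (h0 : 0 < x) (h1 : x < 1) {K : ℕ}
    (H : ∀ a b : ℤ, 1 < b → 1 / (b:ℝ)^K ≤ |x - a / b|) (n : ℕ) (hn : 1 ≤ n) :
    (pq n x : ℝ) ≤ 2 ^ ((K+2)^n) := by
  obtain ⟨m, rfl⟩ : ∃ m, n = m + 1 := ⟨n - 1, by omega⟩
  obtain ⟨p, q, p', q', hq, hq0, hqq, hb, hD, hD'⟩ := key hx h0 h1 H m
  obtain ⟨hi, ht0, ht1⟩ := iter_irr x hx h0 h1 m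
  have hbi := bd_inv H hq ht0 hD hD'
  have hqR : (1:ℝ) ≤ q := by exact_mod_cast hq
  rw [pq, Nat.add_sub_cancel]
  refine (Nat.floor_le (by positivity)).trans (hbi.trans ?_)
  calc (2 * q : ℝ)^K ≤ (2 ^ ((K+2)^m))^K := by gcongr
    _ = 2 ^ ((K+2)^m * K) := by rw [← pow_mul]
    _ ≤ _ := by
      apply pow_le_pow_right₀ (by norm_num)
      rw [pow_succ]; gcongr; omega

lemma lambda_liouville (d : ℕ) (hd : 1 ≤ d) (Φ : ℕ → ℝ) (hΦ : ∀ n, 2 ≤ Φ n)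
    (hb : Filter.Tendsto (fun n => Real.log (Real.log (Φ n)) / n) Filter.atTop Filter.atTop)
    {x : ℝ} (hx : x ∈ Lambda d Φ) : Liouville x := by
  obtain ⟨⟨hx0, hx1⟩, hi, hf⟩ := hx
  by_contra hL
  simp only [Liouville, not_forall, not_exists, not_and, not_lt] at hL
  obtain ⟨K, hK⟩ := hL
  have H : ∀ a b : ℤ, 1 < b → 1 / (b:ℝ)^K ≤ |x - a / b| := by
    intro a b hb
    refine hK a b hb ?_
    have := hi.ne_rational a b
    exact this
  have hx0' : 0 < x := lt_of_le_of_ne hx0 hi.ne_zero.symm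
  have hev := hb.eventually_gt_atTop (Real.log d + d * Real.log (K+2))
  obtain ⟨n, hn, hg, hn1⟩ := (hf.and_eventually (hev.and (eventually_ge_atTop 1))).exists
  have h2 : Φ n ≤ 2 ^ (d * (K+2)^(d*n)) := by
    refine hn.trans ?_
    calc ∏ i ∈ Finset.Icc 1 d, (pq (i * n) x : ℝ) ≤ ∏ i ∈ Finset.Icc 1 d, (2:ℝ) ^ ((K+2)^(d*n)) := by
          apply Finset.prod_le_prod
          · intros; positivity
          · intro i hid
            rw [Finset.mem_Icc] at hid
            refine (pq_bd hi hx0' hx1 H _ (Nat.mul_pos hid.1 hn1)).trans ?_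
            apply pow_le_pow_right₀ (by norm_num)
            apply Nat.pow_le_pow_right (by omega)
            exact Nat.mul_le_mul_right _ hid.2
      _ = _ := by simp [← pow_mul, mul_comm]
  have hΦn := hΦ n
  have hlp : 0 < Real.log (Φ n) := Real.log_pos (by linarith)
  have h3 : Real.log (Φ n) ≤ d * (K+2)^(d*n) := by
    have := Real.log_le_log (by linarith) h2
    rw [Real.log_pow] at this
    push_cast at this
    refine this.trans (mul_le_of_le_one_right (by positivity) ?_)
    linarith [Real.log_two_lt_d9]
  have hd' : (1:ℝ) ≤ d := by exact_mod_cast hd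
  have hn' : (1:ℝ) ≤ n := by exact_mod_cast hn1
  have h4 := Real.log_le_log hlp h3
  rw [Real.log_mul (by positivity) (by positivity), Real.log_pow] at h4
  push_cast at h4
  rw [lt_div_iff₀ (by linarith)] at hg
  nlinarith [Real.log_nonneg hd']

lemma dim_liouville {S : Set ℝ} (hS : ∀ x ∈ S, x ∈ Set.Ico (0:ℝ) 1 ∧ Liouville x) :
    dimH S = 0 := by
  have main : ∀ s : NNReal, 0 < s → μH[(s:ℝ)] S = 0 := by
    intro s hs
    have hs' : (0:ℝ) < s := hs
    obtain ⟨n, hn⟩ := exists_nat_ge (3 / (s:ℝ))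
    have hn3 : 3 ≤ n * (s:ℝ) := by rwa [div_le_iff₀ hs'] at hn
    have hn1 : 1 ≤ n := by
      rcases Nat.eq_zero_or_pos n with h | h
      · subst h; norm_num at hn3
      · exact h
    let f : ℕ → ENNReal := fun j => ENNReal.ofReal (2 * 2^(s:ℝ) * (1 / ((j+1:ℕ):ℝ)^2))
    have hf : ∑' j, f j ≠ ⊤ := by
      have h1 : Summable (fun j : ℕ => 2 * 2^(s:ℝ) * (1 / ((j+1:ℕ):ℝ)^2)) :=
        ((summable_nat_add_iff 1).2 (Real.summable_one_div_nat_pow.2 one_lt_two)).mul_left _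
      exact h1.tsum_ofReal_ne_top
    have hlim := ENNReal.tendsto_sum_nat_add f hf
    have hdiam : ∀ (b : ℕ) (c : ℝ), Metric.ediam (Metric.closedBall c (1 / ((b+1:ℕ):ℝ)^n))
        = ENNReal.ofReal (2 * (1 / ((b+1:ℕ):ℝ)^n)) := by
      intro b c
      rw [Real.closedBall_eq_Icc, Real.ediam_Icc]
      congr 1; ring
    have hle := Measure.hausdorffMeasure_le_liminf_tsum (ι := fun N : ℕ => Σ k : ℕ, Fin (k + N + 2))
      (s:ℝ) S (l := atTop) (fun N : ℕ => ENNReal.ofReal (2 * (1 / ((N:ℝ)+1)))) ?_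
      (fun N i => Metric.closedBall ((i.2 : ℝ) / ((i.1 + N + 1 : ℕ) : ℝ)) (1 / ((i.1 + N + 1 : ℕ):ℝ)^n))
      ?_ ?_
    · refine le_antisymm (hle.trans ?_) (zero_le)
      rw [← hlim.liminf_eq]
      refine liminf_le_liminf (Eventually.of_forall fun N => ?_)
      rw [ENNReal.tsum_sigma']
      refine ENNReal.tsum_le_tsum fun k => ?_
      simp only [hdiam]
      rw [tsum_fintype, Finset.sum_const, Finset.card_univ, Fintype.card_fin, nsmul_eq_mul,
        ENNReal.ofReal_rpow_of_nonneg (by positivity) hs'.le, ← ENNReal.ofReal_natCast,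
        ← ENNReal.ofReal_mul (by positivity)]
      apply ENNReal.ofReal_le_ofReal
      have hB : (1:ℝ) ≤ ((k + N + 1 : ℕ):ℝ) := by exact_mod_cast Nat.le_add_left _ _
      have e : ((k + N + 2 : ℕ):ℝ) = ((k + N + 1 : ℕ):ℝ) + 1 := by push_cast; ring
      rw [e]
      generalize ((k + N + 1 : ℕ):ℝ) = B at hB
      have hB0 : 0 < B := by linarith
      rw [Real.mul_rpow (by norm_num) (by positivity), Real.div_rpow (by norm_num) (by positivity),
        Real.one_rpow, ← Real.rpow_natCast, ← Real.rpow_mul hB0.le]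
      have h3 : B ^ 3 ≤ B ^ ((n:ℝ) * s) := by
        rw [← Real.rpow_natCast]
        exact Real.rpow_le_rpow_of_exponent_le hB (by exact_mod_cast hn3)
      calc (B + 1) * (2^(s:ℝ) * (1 / B ^ ((n:ℝ) * s))) ≤ (2 * B) * (2^(s:ℝ) * (1 / B ^ 3)) := by
            gcongr; linarith
        _ = _ := by field_simp
    · have := (tendsto_one_div_add_atTop_nhds_zero_nat (𝕜 := ℝ)).const_mul 2
      simpa using ENNReal.tendsto_ofReal this
    · refine Eventually.of_forall fun N i => ?_
      rw [hdiam]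
      apply ENNReal.ofReal_le_ofReal
      gcongr
      calc (N:ℝ) + 1 ≤ ((i.1 + N + 1 : ℕ):ℝ) := by push_cast; linarith [Nat.cast_nonneg (α := ℝ) i.1]
        _ ≤ _ := le_self_pow₀ (by exact_mod_cast Nat.le_add_left _ _) (by omega)
    · refine Eventually.of_forall fun N x hx => ?_
      obtain ⟨⟨hx0, hx1⟩, hL⟩ := hS x hx
      obtain ⟨b, ⟨a, -, hab⟩, hbN⟩ :=
        ((hL.frequently_exists_num n).and_eventually (eventually_ge_atTop (N+1))).exists
      obtain ⟨k, rfl⟩ : ∃ k, b = k + N + 1 := ⟨b - (N+1), by omega⟩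
      have hB : (1:ℝ) ≤ ((k + N + 1 : ℕ):ℝ) := by exact_mod_cast Nat.le_add_left _ _
      have hlt : |x - a / ((k + N + 1 : ℕ):ℝ)| < 1 / ((k + N + 1 : ℕ):ℝ) := by
        refine hab.trans_le ?_
        gcongr
        exact le_self_pow₀ hB (by omega)
      have hr : -1 < a ∧ a < ((k + N + 2 : ℕ) : ℤ) := by
        have e : ((k + N + 2 : ℕ):ℝ) = ((k + N + 1 : ℕ):ℝ) + 1 := by push_cast; ring
        rw [← @Int.cast_lt ℝ, ← @Int.cast_lt ℝ, Int.cast_natCast, e]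
        push_cast only [Int.cast_neg, Int.cast_one]
        generalize ((k + N + 1 : ℕ):ℝ) = B at *
        have hB0 : 0 < B := by linarith
        rw [sub_div' hB0.ne', abs_div, abs_of_pos hB0, div_lt_div_iff_of_pos_right hB0, abs_lt] at hlt
        constructor <;> nlinarith
      obtain ⟨m, rfl⟩ := Int.eq_ofNat_of_zero_le (by omega : 0 ≤ a)
      refine mem_iUnion.2 ⟨⟨k, ⟨m, by exact_mod_cast hr.2⟩⟩, ?_⟩
      rw [Metric.mem_closedBall, Real.dist_eq]
      simpa using hab.le
  refine le_antisymm (dimH_le fun d' hd' => ?_) (zero_le)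
  by_contra h
  have : 0 < d' := by
    rw [not_le] at h; exact_mod_cast h
  rw [main d' this] at hd'
  simp at hd'

/-- If `B = ∞` and `b = ∞` (both liminfs are infinite), then `dim_H Λ_d(Φ) = 0`. -/
theorem dimH_lambda_eq_zero (d : ℕ) (hd : 1 ≤ d) (Φ : ℕ → ℝ) (hΦ : ∀ n, 2 ≤ Φ n)
    (hB : Filter.Tendsto (fun n => Real.log (Φ n) / n) Filter.atTop Filter.atTop)
    (hb : Filter.Tendsto (fun n => Real.log (Real.log (Φ n)) / n) Filter.atTop Filter.atTop) :
    dimH (Lambda d Φ) = 0 :=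
  dim_liouville fun _ hx => ⟨hx.1, lambda_liouville d hd Φ hΦ hb hx⟩
end
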